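/- arXiv:1605.03074 — 2 statements merged into one kernel-verified Lean document; each statement's English description precedes it below -/
import Mathlib

section
/- For every positive integer n the following two claims both hold: (1) there exist integers x, y, z, w with w ≠ 0, n = x^2 + y^2 + z^2 + w^2, and x^2 + 24yz a perfect square; (2) there exist integers x, y, z, w with w ≠ 0, n = x^2 + y^2 + z^2 + w^2, and 4x^2·y^2 + 9y^2·z^2 + 36z^2·x^2 a perfect square. -/
/-- The integral ternary quadratic form with diagonal coefficients `a, b, c` and
off-diagonal coefficients `p` (for `yz`), `q` (for `xz`), `r` (for `xy`). -/
def ternaryForm (a b c p q r x y z : ℤ) : ℤ :=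
  a * x ^ 2 + b * y ^ 2 + c * z ^ 2 + 2 * p * y * z + 2 * q * x * z + 2 * r * x * y

/-- Every value of the form is a sum of three squares. -/
def RepresentsThreeSquares (a b c p q r : ℤ) : Prop :=
  ∀ x y z : ℤ, ∃ u v w : ℤ, ternaryForm a b c p q r x y z = u ^ 2 + v ^ 2 + w ^ 2

namespace RepresentsThreeSquares

variable {a b c p q r : ℤ}

lemma of_swap_left (h : RepresentsThreeSquares b a c q p r) :
    RepresentsThreeSquares a b c p q r := by
  intro x y z
  obtain ⟨u, v, w, e⟩ := h y x z
  exact ⟨u, v, w, by rw [← e]; unfold ternaryForm; ring⟩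

lemma of_swap_right (h : RepresentsThreeSquares a c b p r q) :
    RepresentsThreeSquares a b c p q r := by
  intro x y z
  obtain ⟨u, v, w, e⟩ := h x z y
  exact ⟨u, v, w, by rw [← e]; unfold ternaryForm; ring⟩

lemma of_shear_left (k : ℤ)
    (h : RepresentsThreeSquares a (b + 2 * k * r + k ^ 2 * a) c (p + k * q) q (r + k * a)) :
    RepresentsThreeSquares a b c p q r := by
  intro x y z
  obtain ⟨u, v, w, e⟩ := h (x - k * y) y z
  exact ⟨u, v, w, by rw [← e]; unfold ternaryForm; ring⟩

lemma of_shear_right (k : ℤ)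
    (h : RepresentsThreeSquares a b (c + 2 * k * p + k ^ 2 * b) (p + k * b) (q + k * r) r) :
    RepresentsThreeSquares a b c p q r := by
  intro x y z
  obtain ⟨u, v, w, e⟩ := h x (y - k * z) z
  exact ⟨u, v, w, by rw [← e]; unfold ternaryForm; ring⟩

end RepresentsThreeSquares

lemma exists_shift_abs_le (r a : ℤ) (ha : 0 < a) : ∃ k : ℤ, 4 * (r + k * a) ^ 2 ≤ a ^ 2 := by
  have h1 := Int.emod_nonneg r ha.ne'
  have h2 := Int.emod_lt_of_pos r ha
  have h3 := Int.emod_add_mul_ediv r a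
  rcases le_total (2 * (r % a)) a with h | h
  · refine ⟨-(r / a), ?_⟩
    have : r + -(r / a) * a = r % a := by linarith
    rw [this]; nlinarith
  · refine ⟨-(r / a) - 1, ?_⟩
    have : r + (-(r / a) - 1) * a = r % a - a := by linarith
    rw [this]; nlinarith

/-- A positive definite integral ternary form of determinant one represents only sums of three
squares. -/
theorem representsThreeSquares_of_det_eq_one (N : ℕ) :
    ∀ a b c p q r : ℤ, 0 < a → 0 < a * b - r ^ 2 →
      a * b * c + 2 * p * q * r - a * p ^ 2 - b * q ^ 2 - c * r ^ 2 = 1 →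
      a + (a * b - r ^ 2) ≤ N → RepresentsThreeSquares a b c p q r := by
  induction N with
  | zero => intro a b c p q r ha hD _ hN; push_cast at hN; omega
  | succ N ih =>
    intro a b c p q r ha hD hdet hN
    push_cast at hN
    obtain ⟨k, hk⟩ := exists_shift_abs_le (a * p - q * r) (a * b - r ^ 2) hD
    apply RepresentsThreeSquares.of_shear_right k
    have hE : a * p - q * r + k * (a * b - r ^ 2) = a * (p + k * b) - (q + k * r) * r := by ring
    have hdet₁ : a * b * (c + 2 * k * p + k ^ 2 * b) + 2 * (p + k * b) * (q + k * r) * r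
        - a * (p + k * b) ^ 2 - b * (q + k * r) ^ 2
        - (c + 2 * k * p + k ^ 2 * b) * r ^ 2 = 1 := by
      rw [← hdet]; ring
    rw [hE] at hk
    clear hE hdet
    generalize c + 2 * k * p + k ^ 2 * b = c at *
    generalize p + k * b = p at *
    generalize q + k * r = q at *
    have hDF : (a * b - r ^ 2) * (a * c - q ^ 2) = a + (a * p - q * r) ^ 2 := by
      linear_combination a * hdet₁
    have hF : 0 < a * c - q ^ 2 := by
      by_contra! h
      nlinarith [sq_nonneg (a * p - q * r), mul_nonneg hD.le (neg_nonneg.2 h)]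
    rcases lt_or_ge (a * c - q ^ 2) (a * b - r ^ 2) with hlt | hge
    · apply RepresentsThreeSquares.of_swap_right
      exact ih a c b p r q ha hF (by linarith) (by linarith)
    have hD2 : 3 * (a * b - r ^ 2) ^ 2 ≤ 4 * a := by nlinarith
    obtain ⟨l, hl⟩ := exists_shift_abs_le r a ha
    apply RepresentsThreeSquares.of_shear_left l
    have hD' : a * b - r ^ 2 = a * (b + 2 * l * r + l ^ 2 * a) - (r + l * a) ^ 2 := by ring
    have hdet₂ : a * (b + 2 * l * r + l ^ 2 * a) * c + 2 * (p + l * q) * q * (r + l * a)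
        - a * (p + l * q) ^ 2 - (b + 2 * l * r + l ^ 2 * a) * q ^ 2
        - c * (r + l * a) ^ 2 = 1 := by
      rw [← hdet₁]; ring
    have hk' : 4 * (a * (p + l * q) - q * (r + l * a)) ^ 2 ≤
        (a * (b + 2 * l * r + l ^ 2 * a) - (r + l * a) ^ 2) ^ 2 := by
      rw [← hD']; convert hk using 2; ring
    rw [hD'] at hD hN hD2
    clear hk hge hDF hD' hdet₁
    generalize b + 2 * l * r + l ^ 2 * a = b at *
    generalize p + l * q = p at *
    generalize r + l * a = r at *
    have hb : 0 < b := by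
      by_contra! h
      nlinarith [sq_nonneg r, mul_nonneg ha.le (neg_nonneg.2 h)]
    rcases lt_or_ge b a with hlt | hge
    · apply RepresentsThreeSquares.of_swap_left
      exact ih b a c q p r hb (by linarith) (by linarith) (by linarith)
    have ha2 : 3 * a ^ 2 ≤ 4 * (a * b - r ^ 2) := by nlinarith
    have ha1 : a = 1 := by
      have h1 : (3 * a ^ 2) ^ 2 ≤ (4 * (a * b - r ^ 2)) ^ 2 := by gcongr
      by_contra hne
      have h2 : 2 ≤ a := by omega
      have h3 : a * 8 ≤ a * a ^ 3 := by
        gcongr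
        nlinarith [mul_nonneg (sub_nonneg.2 h2) (sub_nonneg.2 h2)]
      nlinarith
    subst ha1
    have hD1 : 1 * b - r ^ 2 = 1 := by nlinarith
    have hr : r = 0 := by nlinarith
    subst hr
    have hb1 : b = 1 := by linarith
    subst hb1
    have hp : p = 0 := by nlinarith
    subst hp
    intro x y z
    refine ⟨x + q * z, y, z, ?_⟩
    have hc : c = 1 + q ^ 2 := by linarith
    subst hc
    unfold ternaryForm
    ring

lemma exists_mul_eq_succ_dvd_add_sq (n : ℕ) (hn : n % 4 = 2) :
    ∃ d P : ℕ, 0 < d ∧ d * n = P + 1 ∧ 0 < P ∧ ∃ r : ℤ, (P : ℤ) ∣ d + r ^ 2 := by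
  have hcop : Nat.Coprime (n - 1) (4 * n) := by
    have h1 : Nat.Coprime (n - 1) n := by
      have : Nat.Coprime (n - 1) (n - 1 + 1) := by simp
      rwa [Nat.sub_add_cancel (by omega)] at this
    have h2 : Nat.Coprime (n - 1) 4 := by
      have : Nat.Coprime (n - 1) (2 ^ 2) :=
        Nat.Coprime.pow_right 2 (Nat.coprime_two_right.2 (Nat.odd_iff.2 (by omega)))
      exact this
    exact Nat.Coprime.mul_right h2 h1
  obtain ⟨P, hgt, hP, hmod⟩ :=
    Nat.forall_exists_prime_gt_and_modEq n (by omega : 4 * n ≠ 0) hcop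
  have hdvd : 4 * n ∣ P - (n - 1) := (Nat.modEq_iff_dvd' (by omega)).1 hmod.symm
  obtain ⟨m, hm⟩ := hdvd
  have hdn : (4 * m + 1) * n = P + 1 := by
    have : (4 * m + 1) * n = 4 * n * m + n := by ring
    omega
  refine ⟨4 * m + 1, P, by omega, hdn, hP.pos, ?_⟩
  have hP4 : P % 4 = 1 := by
    have h : ((4 * m + 1) * n) % 4 = 2 := by
      rw [Nat.mul_mod, hn]; omega
    omega
  have := Fact.mk hP
  have hJ : jacobiSym (-((4 * m + 1 : ℕ) : ℤ)) P = 1 := by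
    have hPodd : Odd P := Nat.odd_iff.2 (by omega)
    have hdodd : Odd (4 * m + 1) := Nat.odd_iff.2 (by omega)
    rw [jacobiSym.neg _ hPodd, ZMod.χ₄_nat_one_mod_four hP4, one_mul,
      jacobiSym.quadratic_reciprocity_one_mod_four' hdodd hP4]
    have h1 : jacobiSym (P : ℤ) (4 * m + 1) = jacobiSym (-1) (4 * m + 1) := by
      apply jacobiSym.mod_left'
      apply Int.ModEq.symm
      rw [Int.modEq_iff_dvd]
      exact ⟨n, by push_cast; have := congrArg (Nat.cast : ℕ → ℤ) hdn; push_cast at this; linarith⟩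
    rw [h1, jacobiSym.at_neg_one hdodd, ZMod.χ₄_nat_one_mod_four (by omega)]
  rw [← jacobiSym.legendreSym.to_jacobiSym] at hJ
  have hne : ((-((4 * m + 1 : ℕ) : ℤ) : ℤ) : ZMod P) ≠ 0 := by
    intro h0
    rw [(legendreSym.eq_zero_iff P _).2 h0] at hJ
    norm_num at hJ
  obtain ⟨s, hs⟩ := (legendreSym.eq_one_iff P hne).1 hJ
  obtain ⟨r, rfl⟩ := ZMod.intCast_surjective s
  refine ⟨r, ?_⟩
  rw [← ZMod.intCast_zmod_eq_zero_iff_dvd]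
  push_cast at hs ⊢
  linear_combination -hs

theorem Nat.exists_three_squares_of_mod_four_eq_two (n : ℕ) (hn : n % 4 = 2) :
    ∃ x y z : ℤ, (n : ℤ) = x ^ 2 + y ^ 2 + z ^ 2 := by
  obtain ⟨d, P, hd, hdn, hP, r, a, ha⟩ := exists_mul_eq_succ_dvd_add_sq n hn
  have hdn' : (d : ℤ) * n = P + 1 := by exact_mod_cast hdn
  have hP' : (0 : ℤ) < P := by exact_mod_cast hP
  have hd' : (0 : ℤ) < d := by exact_mod_cast hd
  have hapos : 0 < a := by
    by_contra! h
    nlinarith [sq_nonneg r, mul_nonneg hP'.le (neg_nonneg.2 h)]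
  have hD : a * P - r ^ 2 = d := by linarith
  obtain ⟨u, v, w, e⟩ := representsThreeSquares_of_det_eq_one (a + (a * P - r ^ 2)).toNat
    a P n 0 1 r hapos (by rw [hD]; exact hd') (by linear_combination (n : ℤ) * hD + hdn')
    (Int.self_le_toNat _) 0 0 1
  exact ⟨u, v, w, by rw [← e]; unfold ternaryForm; ring⟩

lemma exists_orthogonal_of_modEq (n α β γ : ℤ) (h : 14 * n = α ^ 2 + β ^ 2 + γ ^ 2)
    (hβ : 14 ∣ β - 2 * α) (hγ : 14 ∣ γ - 3 * α) :
    ∃ x y z w : ℤ, n = x ^ 2 + y ^ 2 + z ^ 2 + w ^ 2 ∧ x + 2 * y + 3 * z = 0 := by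
  obtain ⟨s, hs⟩ := hβ
  obtain ⟨t, ht⟩ := hγ
  obtain rfl : β = 2 * α + 14 * s := by linarith
  obtain rfl : γ = 3 * α + 14 * t := by linarith
  exact ⟨2 * t - 3 * s, -t, s, α + 2 * s + 3 * t, by linarith, by ring⟩

lemma exists_orthogonal_of_sq_modEq (n α β γ : ℤ) (h : 14 * n = α ^ 2 + β ^ 2 + γ ^ 2)
    (hβ2 : β % 2 = 0) (hαγ : (γ - α) % 2 = 0)
    (hβ : 7 ∣ β ^ 2 - (2 * α) ^ 2) (hγ : 7 ∣ γ ^ 2 - (3 * α) ^ 2) :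
    ∃ x y z w : ℤ, n = x ^ 2 + y ^ 2 + z ^ 2 + w ^ 2 ∧ x + 2 * y + 3 * z = 0 := by
  have h7 : Prime (7 : ℤ) := by norm_num
  rw [sq_sub_sq] at hβ hγ
  rcases h7.dvd_or_dvd hβ with hβ | hβ <;> rcases h7.dvd_or_dvd hγ with hγ | hγ
  · exact exists_orthogonal_of_modEq n α (-β) (-γ) (by linarith) (by omega) (by omega)
  · exact exists_orthogonal_of_modEq n α (-β) γ (by linarith) (by omega) (by omega)
  · exact exists_orthogonal_of_modEq n α β (-γ) (by linarith) (by omega) (by omega)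
  · exact exists_orthogonal_of_modEq n α β γ (by linarith) (by omega) (by omega)

lemma sq_modEq_seven_cases (α β γ : ℤ) (h : 7 ∣ α ^ 2 + β ^ 2 + γ ^ 2) :
    (7 ∣ β ^ 2 - (2 * α) ^ 2 ∧ 7 ∣ γ ^ 2 - (3 * α) ^ 2) ∨
    (7 ∣ β ^ 2 - (2 * γ) ^ 2 ∧ 7 ∣ α ^ 2 - (3 * γ) ^ 2) := by
  have key : ∀ a b c : ZMod 7, a ^ 2 + b ^ 2 + c ^ 2 = 0 →
      (b ^ 2 - (2 * a) ^ 2 = 0 ∧ c ^ 2 - (3 * a) ^ 2 = 0) ∨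
      (b ^ 2 - (2 * c) ^ 2 = 0 ∧ a ^ 2 - (3 * c) ^ 2 = 0) := by decide
  have cast (t : ℤ) : 7 ∣ t ↔ (t : ZMod 7) = 0 := (ZMod.intCast_zmod_eq_zero_iff_dvd t 7).symm
  rw [cast] at h
  simp only [cast]
  push_cast at h ⊢
  exact key _ _ _ h

lemma exists_orthogonal_of_even (n α β γ : ℤ) (h : 14 * n = α ^ 2 + β ^ 2 + γ ^ 2)
    (hβ : β % 2 = 0) (hαγ : (γ - α) % 2 = 0) :
    ∃ x y z w : ℤ, n = x ^ 2 + y ^ 2 + z ^ 2 + w ^ 2 ∧ x + 2 * y + 3 * z = 0 := by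
  rcases sq_modEq_seven_cases α β γ ⟨2 * n, by linarith⟩ with ⟨h1, h2⟩ | ⟨h1, h2⟩
  · exact exists_orthogonal_of_sq_modEq n α β γ h hβ hαγ h1 h2
  · exact exists_orthogonal_of_sq_modEq n γ β α (by linarith) hβ (by omega) h1 h2

/-- Every odd `n` is a sum of four squares with three of the roots orthogonal to `(1, 2, 3)`. -/
theorem exists_four_squares_orthogonal (n : ℕ) (hn : n % 2 = 1) :
    ∃ x y z w : ℤ, (n : ℤ) = x ^ 2 + y ^ 2 + z ^ 2 + w ^ 2 ∧ x + 2 * y + 3 * z = 0 := by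
  obtain ⟨α, β, γ, h⟩ := Nat.exists_three_squares_of_mod_four_eq_two (14 * n) (by omega)
  push_cast at h
  have sq_emod_four (t : ℤ) : (t % 2 = 0 ∧ t ^ 2 % 4 = 0) ∨ (t % 2 = 1 ∧ t ^ 2 % 4 = 1) := by
    rcases Int.even_or_odd' t with ⟨k, rfl | rfl⟩
    · left; ring_nf; omega
    · right; ring_nf; omega
  have hα := sq_emod_four α
  have hβ := sq_emod_four β
  have hγ := sq_emod_four γ
  have hcases : (β % 2 = 0 ∧ (γ - α) % 2 = 0) ∨ (α % 2 = 0 ∧ (γ - β) % 2 = 0) ∨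
      (γ % 2 = 0 ∧ (β - α) % 2 = 0) := by omega
  rcases hcases with ⟨h1, h2⟩ | ⟨h1, h2⟩ | ⟨h1, h2⟩
  · exact exists_orthogonal_of_even n α β γ h h1 h2
  · exact exists_orthogonal_of_even n β α γ (by linarith) h1 h2
  · exact exists_orthogonal_of_even n α γ β (by linarith) h1 h2

lemma exists_three_squares_ne_zero {n x y z : ℤ} (hn : 0 < n) (h : n = x ^ 2 + y ^ 2 + z ^ 2) :
    ∃ u v w : ℤ, w ≠ 0 ∧ n = u ^ 2 + v ^ 2 + w ^ 2 := by
  by_cases hx : x = 0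
  · by_cases hy : y = 0
    · refine ⟨x, y, z, ?_, h⟩
      rintro rfl
      subst hx hy
      simp at h
      omega
    · exact ⟨x, z, y, hy, by linarith⟩
  · exact ⟨y, z, x, hx, by linarith⟩

theorem stmt_17 (n : ℕ) (hn : 0 < n) :
    (∃ x y z w : ℤ, w ≠ 0 ∧ (n : ℤ) = x ^ 2 + y ^ 2 + z ^ 2 + w ^ 2 ∧
        ∃ t : ℤ, x ^ 2 + 24 * y * z = t ^ 2) ∧
    (∃ x y z w : ℤ, w ≠ 0 ∧ (n : ℤ) = x ^ 2 + y ^ 2 + z ^ 2 + w ^ 2 ∧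
        ∃ t : ℤ, 4 * x ^ 2 * y ^ 2 + 9 * y ^ 2 * z ^ 2 + 36 * z ^ 2 * x ^ 2 = t ^ 2) := by
  induction n using Nat.strong_induction_on with
  | _ n ih =>
    have of_three_squares (x y z : ℤ) (h : (n : ℤ) = x ^ 2 + y ^ 2 + z ^ 2) :
        (∃ x y z w : ℤ, w ≠ 0 ∧ (n : ℤ) = x ^ 2 + y ^ 2 + z ^ 2 + w ^ 2 ∧
          ∃ t : ℤ, x ^ 2 + 24 * y * z = t ^ 2) ∧
        (∃ x y z w : ℤ, w ≠ 0 ∧ (n : ℤ) = x ^ 2 + y ^ 2 + z ^ 2 + w ^ 2 ∧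
          ∃ t : ℤ, 4 * x ^ 2 * y ^ 2 + 9 * y ^ 2 * z ^ 2 + 36 * z ^ 2 * x ^ 2 = t ^ 2) := by
      obtain ⟨u, v, w, hw, e⟩ := exists_three_squares_ne_zero (by exact_mod_cast hn) h
      exact ⟨⟨u, v, 0, w, hw, by linarith, u, by ring⟩,
        ⟨u, v, 0, w, hw, by linarith, 2 * u * v, by ring⟩⟩
    rcases Nat.mod_two_eq_zero_or_one n with h2 | h2
    · rcases (by omega : n % 4 = 2 ∨ n % 4 = 0) with h4 | h4
      · obtain ⟨x, y, z, h⟩ := Nat.exists_three_squares_of_mod_four_eq_two n h4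
        exact of_three_squares x y z h
      · obtain ⟨m, rfl⟩ := Nat.dvd_of_mod_eq_zero h4
        obtain ⟨⟨x, y, z, w, hw, e, t, ht⟩, ⟨x', y', z', w', hw', e', t', ht'⟩⟩ :=
          ih m (by omega) (by omega)
        refine ⟨⟨2 * x, 2 * y, 2 * z, 2 * w, by omega, by push_cast; linarith, 2 * t, ?_⟩,
          ⟨2 * x', 2 * y', 2 * z', 2 * w', by omega, by push_cast; linarith, 4 * t', ?_⟩⟩
        · linear_combination 4 * ht
        · linear_combination 16 * ht'
    · obtain ⟨x, y, z, w, e, ho⟩ := exists_four_squares_orthogonal n h2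
      by_cases hw : w = 0
      · subst hw
        exact of_three_squares x y z (by linarith)
      · obtain rfl : x = -2 * y - 3 * z := by linarith
        refine ⟨⟨-2 * y - 3 * z, -y, z, w, hw, by linarith, 2 * y - 3 * z, by ring⟩,
          ⟨y, -2 * y - 3 * z, z, w, hw, by linarith,
            2 * y * (-2 * y - 3 * z) + 6 * y * z + 3 * (-2 * y - 3 * z) * z, by ring⟩⟩
end

section
/- Let λ ∈ {1,2} and m ∈ {2,3}. Then every natural number n can be written as n = x^2 + y^2 + z^2 + w^2 where x and y are integers and z and w are rational numbers with 5z and 5w integers, such that x + 3y + 5z = λ·r^m for some nonnegative integer r. -/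
/-- `n` is a sum of three integer squares. -/
def IsSumThreeSq (n : ℤ) : Prop := ∃ x y z : ℤ, n = x ^ 2 + y ^ 2 + z ^ 2

theorem exists_neg_le_two_mul_add_mul_le (a b : ℤ) (ha : 0 < a) :
    ∃ k : ℤ, -a ≤ 2 * (b + k * a) ∧ 2 * (b + k * a) ≤ a := by
  refine ⟨-((2 * b + a) / (2 * a)), ?_⟩
  have h1 := Int.emod_add_mul_ediv (2 * b + a) (2 * a)
  have h2 := Int.emod_nonneg (2 * b + a) (by omega : 2 * a ≠ 0)
  have h3 := Int.emod_lt_of_pos (2 * b + a) (by omega : 0 < 2 * a)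
  constructor <;> nlinarith

theorem exists_reduced_binary (A B C : ℤ) (hA : 0 < A) (hD : 0 < A * C - B ^ 2) :
    ∃ p q r s : ℤ, p * s - q * r = 1 ∧ 0 < A * p ^ 2 + 2 * B * p * r + C * r ^ 2 ∧
      3 * (A * p ^ 2 + 2 * B * p * r + C * r ^ 2) ^ 2 ≤ 4 * (A * C - B ^ 2) := by
  induction hN : A.toNat using Nat.strong_induction_on generalizing A B C with
  | _ N ih =>
    obtain ⟨k, hk1, hk2⟩ := exists_neg_le_two_mul_add_mul_le A B hA
    obtain ⟨B', hB'⟩ : ∃ B', B' = B + k * A := ⟨_, rfl⟩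
    obtain ⟨C', hC'⟩ : ∃ C', C' = A * k ^ 2 + 2 * B * k + C := ⟨_, rfl⟩
    rw [← hB'] at hk1 hk2
    have hdet : A * C' - B' ^ 2 = A * C - B ^ 2 := by rw [hB', hC']; ring
    have hC'pos : 0 < C' := by
      by_contra! h
      nlinarith [sq_nonneg B']
    rcases lt_or_ge C' A with h | h
    · obtain ⟨p, q, r, s, h1, h2, h3⟩ :=
        ih C'.toNat (by omega) C' (-B') A hC'pos (by linarith) rfl
      have key : A * (-r + k * p) ^ 2 + 2 * B * (-r + k * p) * p + C * p ^ 2 =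
          C' * p ^ 2 + 2 * -B' * p * r + A * r ^ 2 := by rw [hB', hC']; ring
      refine ⟨-r + k * p, -s + k * q, p, q, by linarith, ?_, ?_⟩ <;> rw [key] <;> linarith
    · refine ⟨1, 0, 0, 1, by norm_num, by simpa using hA, ?_⟩
      rw [← hdet]
      nlinarith

theorem isSumTwoSq_of_binary (A B C : ℤ) (hA : 0 < A) (hD : A * C - B ^ 2 = 1) (y z : ℤ) :
    ∃ u v : ℤ, A * y ^ 2 + 2 * B * y * z + C * z ^ 2 = u ^ 2 + v ^ 2 := by
  obtain ⟨p, q, r, s, h1, h2, h3⟩ := exists_reduced_binary A B C hA (by omega)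
  have hA' : A * p ^ 2 + 2 * B * p * r + C * r ^ 2 = 1 := by nlinarith
  obtain ⟨y', z', rfl, rfl⟩ : ∃ y' z', y = p * y' + q * z' ∧ z = r * y' + s * z' :=
    ⟨s * y - q * z, -r * y + p * z, by linear_combination -y * h1, by linear_combination -z * h1⟩
  refine ⟨y' + (A * p * q + B * (p * s + q * r) + C * r * s) * z', z', ?_⟩
  have hdet : (A * p ^ 2 + 2 * B * p * r + C * r ^ 2) * (A * q ^ 2 + 2 * B * q * s + C * s ^ 2) -
      (A * p * q + B * (p * s + q * r) + C * r * s) ^ 2 = 1 := by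
    calc _ = (A * C - B ^ 2) * (p * s - q * r) ^ 2 := by ring
      _ = 1 := by rw [hD, h1]; norm_num
  rw [hA'] at hdet
  linear_combination y' ^ 2 * hA' + z' ^ 2 * hdet

theorem isSumThreeSq_of_ternary (a b c f g h : ℤ) (ha : 0 < a) (hab : 0 < a * b - h ^ 2)
    (hdet : a * b * c + 2 * f * g * h - a * f ^ 2 - b * g ^ 2 - c * h ^ 2 = 1) (x y z : ℤ) :
    IsSumThreeSq (a * x ^ 2 + b * y ^ 2 + c * z ^ 2 +
      2 * (f * y * z + g * x * z + h * x * y)) := by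
  induction hN : a.toNat using Nat.strong_induction_on generalizing a b c f g h x y z with
  | _ N ih =>
    have hD : (a * b - h ^ 2) * (a * c - g ^ 2) - (a * f - g * h) ^ 2 = a := by
      linear_combination a * hdet
    rcases eq_or_ne a 1 with rfl | ha1
    · obtain ⟨u, v, huv⟩ := isSumTwoSq_of_binary _ _ _ hab hD y z
      exact ⟨x + h * y + g * z, u, v, by linear_combination huv⟩
    obtain ⟨p, q, r, s, h1, h2, h3⟩ := exists_reduced_binary _ _ _ hab (by rw [hD]; exact ha)
    rw [hD] at h3
    obtain ⟨k, hk1, hk2⟩ := exists_neg_le_two_mul_add_mul_le a (h * p + g * r) ha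
    obtain ⟨h', hh'⟩ : ∃ h', h' = h * p + g * r + k * a := ⟨_, rfl⟩
    obtain ⟨b', hb'⟩ : ∃ b', b' = b * p ^ 2 + 2 * f * p * r + c * r ^ 2 +
      2 * k * (h * p + g * r) + k ^ 2 * a := ⟨_, rfl⟩
    obtain ⟨A', hA'⟩ : ∃ A', A' = (a * b - h ^ 2) * p ^ 2 + 2 * (a * f - g * h) * p * r +
      (a * c - g ^ 2) * r ^ 2 := ⟨_, rfl⟩
    rw [← hh'] at hk1 hk2
    rw [← hA'] at h2 h3
    have hab' : b' * a - h' ^ 2 = A' := by rw [hb', hh', hA']; ring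
    have hb'pos : 0 < b' := by
      by_contra! hb
      nlinarith [sq_nonneg h']
    have hb'lt : b' < a := by
      by_contra! hb
      have ha2 : 2 ≤ a := by omega
      have e1 : 4 * h' ^ 2 ≤ a ^ 2 := by nlinarith
      have e2 : 3 * a ≤ 2 * A' := by nlinarith
      nlinarith
    obtain ⟨y', z', rfl, rfl⟩ : ∃ y' z', y = p * y' + q * z' ∧ z = r * y' + s * z' :=
      ⟨s * y - q * z, -r * y + p * z, by linear_combination -y * h1,
        by linear_combination -z * h1⟩
    have hdet' : b' * a * (b * q ^ 2 + 2 * f * q * s + c * s ^ 2) + 2 * (h * q + g * s) *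
        (b * p * q + f * (p * s + q * r) + c * r * s + k * (h * q + g * s)) * h' -
        b' * (h * q + g * s) ^ 2 -
        a * (b * p * q + f * (p * s + q * r) + c * r * s + k * (h * q + g * s)) ^ 2 -
        (b * q ^ 2 + 2 * f * q * s + c * s ^ 2) * h' ^ 2 = 1 := by
      calc _ = (a * b * c + 2 * f * g * h - a * f ^ 2 - b * g ^ 2 - c * h ^ 2) *
            (p * s - q * r) ^ 2 := by rw [hb', hh']; ring
        _ = 1 := by rw [hdet, h1]; norm_num
    convert ih b'.toNat (by omega) b' a _ _ _ h' hb'pos (by rw [hab']; exact h2) hdet'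
      y' (x - k * y') z' rfl using 1
    rw [hb', hh']
    ring

theorem isSumThreeSq_of_dvd (n d x : ℤ) (hd : 0 < d) (hn : 0 < d * n - 1)
    (h : d * n - 1 ∣ x ^ 2 + d) : IsSumThreeSq n := by
  obtain ⟨a, ha⟩ := h
  have ha0 : 0 < a := by
    by_contra! h0
    nlinarith [sq_nonneg x]
  simpa using isSumThreeSq_of_ternary a (d * n - 1) n 0 1 x ha0 (by linarith)
    (by linear_combination (-n) * ha) 0 0 1

theorem exists_dvd_sq_add_of_jacobiSym (p d : ℕ) [Fact p.Prime] (h : jacobiSym (-(d : ℤ)) p = 1) :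
    ∃ x : ℤ, (p : ℤ) ∣ x ^ 2 + d := by
  obtain ⟨y, hy⟩ := ZMod.isSquare_of_jacobiSym_eq_one h
  obtain ⟨x, rfl⟩ := ZMod.intCast_surjective y
  refine ⟨x, (ZMod.intCast_zmod_eq_zero_iff_dvd _ p).1 ?_⟩
  push_cast at hy ⊢
  linear_combination -hy

open NumberTheorySymbols in
theorem isSumThreeSq_of_mod_four_eq_two (n : ℕ) (hn : n % 4 = 2) : IsSumThreeSq n := by
  have hcop : (n - 1).Coprime (4 * n) := by
    refine Nat.Coprime.mul_right ?_ ?_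
    · exact Nat.Coprime.pow_right 2 (Nat.coprime_two_right.2 (by rw [Nat.odd_iff]; omega))
    · exact (Nat.coprime_self_sub_left (by omega)).2 (by simp)
  obtain ⟨p, hpn, hp, hmod⟩ := Nat.forall_exists_prime_gt_and_modEq n (by omega) hcop
  obtain ⟨v, hv⟩ := (Nat.modEq_iff_dvd' (by omega)).1 hmod.symm
  have := Fact.mk hp
  have hpd : p + 1 = (4 * v + 1) * n := by
    have : (4 * v + 1) * n = 4 * n * v + n := by ring
    omega
  have hp4 : p % 4 = 1 := by
    have : 4 * n * v = 4 * (n * v) := by ring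
    omega
  have hodd : Odd (4 * v + 1) := ⟨2 * v, by ring⟩
  have hpd' : (p : ℤ) + 1 = (4 * v + 1 : ℕ) * n := by exact_mod_cast hpd
  have hJ : J(-((4 * v + 1 : ℕ) : ℤ) | p) = 1 := by
    rw [jacobiSym.neg _ (Nat.odd_iff.2 (by omega)), ZMod.χ₄_nat_one_mod_four hp4, one_mul,
      jacobiSym.quadratic_reciprocity_one_mod_four' hodd hp4,
      jacobiSym.mod_left' (a₂ := -1)
        (Int.modEq_iff_dvd.2 ⟨-n, by linear_combination -hpd'⟩),
      jacobiSym.at_neg_one hodd, ZMod.χ₄_nat_one_mod_four (by omega)]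
  obtain ⟨x, hx⟩ := exists_dvd_sq_add_of_jacobiSym p (4 * v + 1) hJ
  have hp' : ((4 * v + 1 : ℕ) : ℤ) * n - 1 = p := by linarith
  exact isSumThreeSq_of_dvd n (4 * v + 1 : ℕ) x (by positivity)
    (by rw [hp']; exact_mod_cast hp.pos) (by rwa [hp'])

open NumberTheorySymbols in
theorem isSumThreeSq_of_odd (n : ℕ) (hn : n % 8 = 1 ∨ n % 8 = 3 ∨ n % 8 = 5) :
    IsSumThreeSq n := by
  rcases eq_or_ne n 1 with rfl | hn1
  · exact ⟨1, 0, 0, by norm_num⟩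
  obtain ⟨c, t, hc, ht, htc⟩ : ∃ c t : ℕ, (c = 1 ∧ n % 8 = 3 ∨ c = 3 ∧ n % 8 ≠ 3) ∧
      2 * t + 1 = c * n ∧ (t % 4 = 1 ∨ t % 4 = 3 ∧ c = 3) := by
    by_cases h3 : n % 8 = 3
    · exact ⟨1, (n - 1) / 2, by omega, by omega, by omega⟩
    · exact ⟨3, (3 * n - 1) / 2, by omega, by omega, by omega⟩
  have hcop : t.Coprime (4 * n) := by
    refine Nat.Coprime.mul_right ?_ ?_
    · exact Nat.Coprime.pow_right 2 (Nat.coprime_two_right.2 (by rw [Nat.odd_iff]; omega))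
    · have h : (2 * t).Coprime (2 * t + 1) := by simp
      rw [ht] at h
      exact h.coprime_mul_left.coprime_mul_left_right
  obtain ⟨p, hpn, hp, hmod⟩ := Nat.forall_exists_prime_gt_and_modEq (t + n) (by omega) hcop
  obtain ⟨v, hv⟩ := (Nat.modEq_iff_dvd' (by omega)).1 hmod.symm
  have := Fact.mk hp
  obtain ⟨d, hd⟩ : ∃ d, d = 8 * v + c := ⟨_, rfl⟩
  have hpd : 2 * p + 1 = d * n := by
    have : d * n = 2 * (4 * n * v) + c * n := by rw [hd]; ring
    omega
  have hp4 : p % 4 = t % 4 := by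
    have : 4 * n * v = 4 * (n * v) := by ring
    omega
  have hodd : Odd d := by rw [Nat.odd_iff]; omega
  have hpodd : Odd p := by rw [Nat.odd_iff]; omega
  have hpd' : 2 * (p : ℤ) + 1 = d * n := by exact_mod_cast hpd
  have hneg2 : J(-2 | d) = 1 := by
    rw [jacobiSym.at_neg_two hodd, ZMod.χ₈'_nat_eq_if_mod_eight, if_neg (by omega),
      if_pos (by omega)]
  have hpJ : J(p | d) = 1 := by
    have h : J(-2 * p | d) = 1 := by
      rw [jacobiSym.mod_left' (a₂ := 1) (Int.modEq_iff_dvd.2 ⟨n, by linear_combination hpd'⟩),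
        jacobiSym.one_left]
    rwa [jacobiSym.mul_left, hneg2, one_mul] at h
  have hJ : J(-(d : ℤ) | p) = 1 := by
    rw [jacobiSym.neg _ hpodd]
    rcases htc with h | ⟨h, hc3⟩
    · rw [ZMod.χ₄_nat_one_mod_four (by omega), one_mul,
        jacobiSym.quadratic_reciprocity_one_mod_four' hodd (by omega), hpJ]
    · rw [ZMod.χ₄_nat_three_mod_four (by omega),
        jacobiSym.quadratic_reciprocity_three_mod_four (by omega) (by omega), hpJ]
      norm_num
  obtain ⟨x, hx, hx2⟩ : ∃ x : ℤ, (p : ℤ) ∣ x ^ 2 + d ∧ (2 : ℤ) ∣ x ^ 2 + d := by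
    have hd2 : (d : ℤ) % 2 = 1 := by exact_mod_cast Nat.odd_iff.1 hodd
    have hp2 : (p : ℤ) % 2 = 1 := by exact_mod_cast Nat.odd_iff.1 hpodd
    have hpar : ∀ x : ℤ, x % 2 = 1 → (2 : ℤ) ∣ x ^ 2 + d := fun x h ↦ by
      obtain ⟨y, rfl⟩ : ∃ y, x = 2 * y + 1 := ⟨x / 2, by omega⟩
      obtain ⟨e, he⟩ : ∃ e, (d : ℤ) = 2 * e + 1 := ⟨d / 2, by omega⟩
      exact ⟨2 * y ^ 2 + 2 * y + e + 1, by rw [he]; ring⟩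
    obtain ⟨x, hx⟩ := exists_dvd_sq_add_of_jacobiSym p d hJ
    rcases Int.emod_two_eq_zero_or_one x with h | h
    · refine ⟨x + p, ?_, hpar _ (by omega)⟩
      rw [show (x + p) ^ 2 + (d : ℤ) = x ^ 2 + d + p * (2 * x + p) by ring]
      exact dvd_add hx (dvd_mul_right _ _)
    · exact ⟨x, hx, hpar x h⟩
  have hp' : (d : ℤ) * n - 1 = 2 * p := by linarith
  refine isSumThreeSq_of_dvd n d x (by exact_mod_cast hodd.pos)
    (by rw [hp']; have := hp.pos; positivity) ?_
  rw [hp']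
  refine IsCoprime.mul_dvd ?_ hx2 hx
  exact_mod_cast (Nat.isCoprime_iff_coprime (m := 2) (n := p)).2 (Nat.coprime_two_left.2 hpodd)

theorem isSumThreeSq_of_mod_eight (n : ℤ) (hn0 : 0 ≤ n)
    (hn : n % 8 = 1 ∨ n % 8 = 2 ∨ n % 8 = 3 ∨ n % 8 = 5 ∨ n % 8 = 6) : IsSumThreeSq n := by
  lift n to ℕ using hn0
  by_cases h : n % 4 = 2
  · exact isSumThreeSq_of_mod_four_eq_two n h
  · exact isSumThreeSq_of_odd n (by omega)

theorem IsSumThreeSq.sq_mul {n : ℤ} (h : IsSumThreeSq n) (e : ℤ) : IsSumThreeSq (e ^ 2 * n) := by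
  obtain ⟨x, y, z, rfl⟩ := h
  exact ⟨e * x, e * y, e * z, by ring⟩

theorem exists_isSumThreeSq_sub_sq_of_mod_eight_eq_five (l : ℤ) (hl : l = 1 ∨ l = 2) (m : ℕ)
    (hm : m = 2 ∨ m = 3) (t : ℤ) (ht0 : 0 ≤ t) (ht : t % 8 = 5) (j : ℕ) (hj : j < m) :
    ∃ r : ℕ, IsSumThreeSq (35 * (4 ^ j * t) - (l * (r : ℤ) ^ m) ^ 2) := by
  obtain rfl | rfl | ⟨rfl, rfl⟩ : j = 0 ∨ j = 1 ∨ j = 2 ∧ m = 3 := by omega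
  · refine ⟨1, isSumThreeSq_of_mod_eight _ ?_ ?_⟩ <;> rcases hl with rfl | rfl <;>
      norm_num <;> omega
  · rcases hl with rfl | rfl
    · refine ⟨1, isSumThreeSq_of_mod_eight _ ?_ ?_⟩ <;> norm_num <;> omega
    · have h := (isSumThreeSq_of_mod_eight (35 * t - 1) (by omega) (by omega)).sq_mul 2
      exact ⟨1, by convert h using 1; norm_num; ring⟩
  · rcases hl with rfl | rfl
    · have h := (isSumThreeSq_of_mod_eight (35 * t - 4) (by omega) (by omega)).sq_mul 4
      exact ⟨2, by convert h using 1; norm_num; ring⟩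
    · have h := (isSumThreeSq_of_mod_eight (140 * t - 1) (by omega) (by omega)).sq_mul 2
      exact ⟨1, by convert h using 1; norm_num; ring⟩

theorem exists_isSumThreeSq_sub_sq (l : ℤ) (hl : l = 1 ∨ l = 2) (m : ℕ)
    (hm : m = 2 ∨ m = 3) (n : ℕ) :
    ∃ r : ℕ, IsSumThreeSq (35 * n - (l * (r : ℤ) ^ m) ^ 2) := by
  have hm0 : m ≠ 0 := by omega
  rcases eq_or_ne n 0 with rfl | hn
  · exact ⟨0, 0, 0, 0, by simp [hm0]⟩
  obtain ⟨k, t, ht, rfl⟩ := Nat.exists_eq_pow_mul_and_not_dvd hn 4 (by norm_num)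
  by_cases ht5 : t % 8 = 5
  · obtain ⟨r, hr⟩ := exists_isSumThreeSq_sub_sq_of_mod_eight_eq_five l hl m hm t (by omega)
      (by omega) (k % m) (Nat.mod_lt _ (by omega))
    refine ⟨2 ^ (k / m) * r, ?_⟩
    convert hr.sq_mul ((2 ^ (k / m)) ^ m) using 1
    have h4 : (4 : ℤ) ^ k = ((2 ^ (k / m)) ^ m) ^ 2 * 4 ^ (k % m) := by
      conv_lhs => rw [← Nat.div_add_mod k m, pow_add]
      rw [show (4 : ℤ) = 2 ^ 2 by norm_num]
      congr 1
      rw [← pow_mul, ← pow_mul, ← pow_mul]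
      congr 1
      ring
    push_cast
    rw [h4]
    ring
  · refine ⟨0, ?_⟩
    convert (isSumThreeSq_of_mod_eight (35 * t) (by omega) (by omega)).sq_mul (2 ^ k) using 1
    have h4 : (4 : ℤ) ^ k = (2 ^ k) ^ 2 := by rw [← pow_mul, mul_comm, pow_mul]; norm_num
    push_cast
    rw [h4, zero_pow hm0]
    ring

open scoped Quaternion in
theorem Quaternion.exists_components_eq {R : Type*} [CommRing R] (a b c d : R) :
    ∃ q : ℍ[R], q.re = a ∧ q.imI = b ∧ q.imJ = c ∧ q.imK = d :=
  ⟨⟨a, b, c, d⟩, rfl, rfl, rfl, rfl⟩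

open scoped Quaternion in
theorem Quaternion.exists_eq_mul_of_dvd (p : ℤ) (hp : p ≠ 0) (a g : ℍ[ℤ]) (ha : normSq a = p)
    (hre : p ∣ (star a * g).re) (hi : p ∣ (star a * g).imI) (hj : p ∣ (star a * g).imJ)
    (hk : p ∣ (star a * g).imK) : ∃ b : ℍ[ℤ], g = a * b := by
  obtain ⟨b0, h0⟩ := hre
  obtain ⟨b1, h1⟩ := hi
  obtain ⟨b2, h2⟩ := hj
  obtain ⟨b3, h3⟩ := hk
  obtain ⟨b, rfl, rfl, rfl, rfl⟩ := exists_components_eq b0 b1 b2 b3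
  refine ⟨b, ?_⟩
  have h : star a * g = p • b := by
    ext <;> simp only [h0, h1, h2, h3, re_smul, imI_smul, imJ_smul, imK_smul, smul_eq_mul]
  have h' : p • g = p • (a * b) := by
    rw [← mul_smul_comm, ← h, ← mul_assoc, self_mul_star, ha, coe_mul_eq_smul]
  exact smul_right_injective _ hp h'

/-- Whether every integer quaternion with norm divisible by `p` is divisible on the left by some
quaternion in `L`, tested on coordinates below `p` by the divisibility of `star e * g`. -/
def Quaternion.coversNormZero (p : ℕ) (L : List (ℤ × ℤ × ℤ × ℤ)) : Bool :=
  (List.range p).all fun a ↦ (List.range p).all fun b ↦ (List.range p).all fun c ↦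
    (List.range p).all fun d ↦ (a * a + b * b + c * c + d * d) % p != 0 || L.any fun e ↦
      (e.1 * a + e.2.1 * b + e.2.2.1 * c + e.2.2.2 * d) % p == 0 &&
      (e.1 * b - e.2.1 * a - e.2.2.1 * d + e.2.2.2 * c) % p == 0 &&
      (e.1 * c + e.2.1 * d - e.2.2.1 * a - e.2.2.2 * b) % p == 0 &&
      (e.1 * d - e.2.1 * c + e.2.2.1 * b - e.2.2.2 * a) % p == 0

open scoped Quaternion in
theorem Quaternion.exists_eq_mul_normSq_eq (p : ℕ) (hp : p ≠ 0) (L : List (ℤ × ℤ × ℤ × ℤ))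
    (hL : ∀ e ∈ L, e.1 ^ 2 + e.2.1 ^ 2 + e.2.2.1 ^ 2 + e.2.2.2 ^ 2 = p)
    (H : coversNormZero p L) (g : ℍ[ℤ]) (hg : (p : ℤ) ∣ normSq g) :
    ∃ a b : ℍ[ℤ], g = a * b ∧ normSq a = p := by
  rw [← ZMod.intCast_zmod_eq_zero_iff_dvd, normSq_def'] at hg
  have : NeZero p := ⟨hp⟩
  simp only [coversNormZero, List.all_eq_true, List.mem_range, Bool.or_eq_true, bne_iff_ne,
    List.any_eq_true, Bool.and_eq_true, beq_iff_eq, ← Int.dvd_iff_emod_eq_zero, and_assoc] at H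
  obtain ⟨e, he, h⟩ := (H _ (ZMod.val_lt (g.re : ZMod p)) _ (ZMod.val_lt (g.imI : ZMod p))
    _ (ZMod.val_lt (g.imJ : ZMod p)) _ (ZMod.val_lt (g.imK : ZMod p))).resolve_left <| by
      rw [not_not, ← Nat.dvd_iff_mod_eq_zero, ← ZMod.natCast_eq_zero_iff, ← hg]
      simp [sq]
  simp only [← ZMod.intCast_zmod_eq_zero_iff_dvd, Int.cast_add, Int.cast_sub, Int.cast_mul,
    Int.cast_natCast, ZMod.natCast_zmod_val] at h
  obtain ⟨h0, h1, h2, h3⟩ := h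
  obtain ⟨a, a0, a1, a2, a3⟩ := exists_components_eq e.1 e.2.1 e.2.2.1 e.2.2.2
  have ha : normSq a = p := by rw [normSq_def', a0, a1, a2, a3, hL e he]
  obtain ⟨b, hb⟩ := exists_eq_mul_of_dvd p (by exact_mod_cast hp) a g ha
    (by rw [← ZMod.intCast_zmod_eq_zero_iff_dvd, ← h0]; simp [a0, a1, a2, a3])
    (by rw [← ZMod.intCast_zmod_eq_zero_iff_dvd, ← h1]; simp [a0, a1, a2, a3]; ring)
    (by rw [← ZMod.intCast_zmod_eq_zero_iff_dvd, ← h2]; simp [a0, a1, a2, a3]; ring)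
    (by rw [← ZMod.intCast_zmod_eq_zero_iff_dvd, ← h3]; simp [a0, a1, a2, a3]; ring)
  exact ⟨_, b, hb, ha⟩

theorem Quaternion.coversNormZero_five : coversNormZero 5
    [(2, 1, 0, 0), (2, 0, 1, 0), (2, 0, 0, 1), (2, 0, 0, -1), (2, 0, -1, 0), (2, -1, 0, 0)] := by
  decide +kernel

theorem Quaternion.coversNormZero_seven : coversNormZero 7
    [(2, 1, 1, 1), (2, 1, 1, -1), (2, 1, -1, 1), (2, 1, -1, -1), (2, -1, 1, 1), (2, -1, 1, -1),
      (2, -1, -1, 1), (2, -1, -1, -1)] := by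
  decide +kernel

open scoped Quaternion in
theorem Quaternion.exists_eq_mul_normSq_eq_five (g : ℍ[ℤ]) (hg : 5 ∣ normSq g) :
    ∃ a b : ℍ[ℤ], g = a * b ∧ normSq a = 5 :=
  exists_eq_mul_normSq_eq 5 (by norm_num) _
    (by decide) coversNormZero_five g (mod_cast hg)

open scoped Quaternion in
theorem Quaternion.exists_eq_mul_normSq_eq_seven (g : ℍ[ℤ]) (hg : 7 ∣ normSq g) :
    ∃ a b : ℍ[ℤ], g = a * b ∧ normSq a = 7 :=
  exists_eq_mul_normSq_eq 7 (by norm_num) _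
    (by decide) coversNormZero_seven g (mod_cast hg)

open scoped Quaternion in
theorem Quaternion.exists_eq_mul_normSq_eq_thirtyFive (g : ℍ[ℤ]) (hg : 35 ∣ normSq g) :
    ∃ a b : ℍ[ℤ], g = a * b ∧ normSq a = 35 := by
  obtain ⟨a, b, rfl, ha⟩ := exists_eq_mul_normSq_eq_five g (dvd_trans (by norm_num) hg)
  rw [map_mul, ha] at hg
  obtain ⟨c, d, rfl, hc⟩ := exists_eq_mul_normSq_eq_seven b (by omega)
  exact ⟨a * c, d, (mul_assoc _ _ _).symm, by rw [map_mul, ha, hc]; norm_num⟩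

theorem eq_of_sum_four_sq_eq_thirtyFive (a b c d : ℕ) (hab : a ≤ b) (hbc : b ≤ c) (hcd : c ≤ d)
    (h : a ^ 2 + b ^ 2 + c ^ 2 + d ^ 2 = 35) :
    (a = 0 ∧ b = 1 ∧ c = 3 ∧ d = 5) ∨ (a = 1 ∧ b = 3 ∧ c = 3 ∧ d = 4) := by
  have hd : d ≤ 5 := by nlinarith
  have hc : c ≤ 5 := by omega
  have hb : b ≤ 5 := by omega
  have ha : a ≤ 5 := by omega
  interval_cases d <;> interval_cases c <;> first | omega | skip
  all_goals interval_cases b <;> first | omega | skip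
  all_goals interval_cases a <;> omega

theorem exists_linear_form_of_sum_sq_eq_thirtyFive (a b : Fin 4 → ℤ) (ha : ∑ i, a i ^ 2 = 35) :
    ∃ c : Fin 4 → ℤ, ∑ i, c i ^ 2 = ∑ i, b i ^ 2 ∧
      (∑ i, a i * b i = c 1 + 3 * c 2 + 5 * c 3 ∨
        ∑ i, a i * b i = c 0 + 3 * c 1 + 3 * c 2 + 4 * c 3) := by
  obtain ⟨σ, hσ⟩ : ∃ σ : Equiv.Perm (Fin 4), Monotone ((fun i ↦ (a i).natAbs) ∘ σ) :=
    ⟨_, Tuple.monotone_sort _⟩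
  have hsign : ∀ x : ℤ, ∃ s : ℤ, s ^ 2 = 1 ∧ x = s * x.natAbs := fun x ↦ by
    rcases x.natAbs_eq with h | h
    · exact ⟨1, by norm_num, by omega⟩
    · exact ⟨-1, by norm_num, by omega⟩
  choose s hs1 hs2 using fun i ↦ hsign (a i)
  have hsum : ∑ i, (a (σ i)).natAbs ^ 2 = 35 := by
    zify
    simp only [sq_abs]
    rw [Equiv.sum_comp σ fun i ↦ a i ^ 2, ha]
  refine ⟨fun i ↦ s (σ i) * b (σ i), ?_, ?_⟩
  · rw [← Equiv.sum_comp σ fun i ↦ b i ^ 2]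
    exact Finset.sum_congr rfl fun i _ ↦ by rw [mul_pow, hs1, one_mul]
  · have hab : ∑ i, a i * b i = ∑ i, ((a (σ i)).natAbs : ℤ) * (s (σ i) * b (σ i)) := by
      rw [← Equiv.sum_comp σ]
      refine Finset.sum_congr rfl fun i _ ↦ ?_
      conv_lhs => rw [hs2 (σ i)]
      ring
    rw [hab]
    simp only [Fin.sum_univ_four] at hsum ⊢
    rcases eq_of_sum_four_sq_eq_thirtyFive _ _ _ _ (hσ (by decide : (0 : Fin 4) ≤ 1))
      (hσ (by decide : (1 : Fin 4) ≤ 2)) (hσ (by decide : (2 : Fin 4) ≤ 3)) hsum with h | h <;>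
    · obtain ⟨h0, h1, h2, h3⟩ := h
      simp only [Function.comp_apply] at h0 h1 h2 h3
      rw [h0, h1, h2, h3]
      first | (left; push_cast; ring1) | (right; push_cast; ring1)

theorem exists_rat_of_linear_form (c : Fin 4 → ℤ) (t : ℤ)
    (h : t = c 1 + 3 * c 2 + 5 * c 3 ∨ t = c 0 + 3 * c 1 + 3 * c 2 + 4 * c 3) :
    ∃ (x y : ℤ) (z w : ℚ), ((∑ i, c i ^ 2 : ℤ) : ℚ) = (x : ℚ) ^ 2 + (y : ℚ) ^ 2 + z ^ 2 + w ^ 2 ∧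
      (∃ Z : ℤ, 5 * z = (Z : ℚ)) ∧ (∃ W : ℤ, 5 * w = (W : ℚ)) ∧
      (x : ℚ) + 3 * (y : ℚ) + 5 * z = t := by
  simp only [Fin.sum_univ_four]
  rcases h with rfl | rfl
  · refine ⟨c 1, c 2, c 3, c 0, ?_, ⟨5 * c 3, ?_⟩, ⟨5 * c 0, ?_⟩, ?_⟩ <;> push_cast <;> ring
  · refine ⟨c 0, c 1, (3 * c 2 + 4 * c 3) / 5, (4 * c 2 - 3 * c 3) / 5, ?_,
      ⟨3 * c 2 + 4 * c 3, ?_⟩, ⟨4 * c 2 - 3 * c 3, ?_⟩, ?_⟩ <;> push_cast <;> ring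

theorem exists_rat_of_eq_sum_four_sq (n : ℕ) (t A B C : ℤ)
    (h : 35 * (n : ℤ) = t ^ 2 + A ^ 2 + B ^ 2 + C ^ 2) :
    ∃ (x y : ℤ) (z w : ℚ), (n : ℚ) = (x : ℚ) ^ 2 + (y : ℚ) ^ 2 + z ^ 2 + w ^ 2 ∧
      (∃ Z : ℤ, 5 * z = (Z : ℚ)) ∧ (∃ W : ℤ, 5 * w = (W : ℚ)) ∧
      (x : ℚ) + 3 * (y : ℚ) + 5 * z = t := by
  obtain ⟨g, rfl, rfl, rfl, rfl⟩ := Quaternion.exists_components_eq t A B C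
  rw [← Quaternion.normSq_def'] at h
  obtain ⟨a, b, hab, ha⟩ := Quaternion.exists_eq_mul_normSq_eq_thirtyFive g ⟨n, h.symm⟩
  have hb : Quaternion.normSq b = n := by
    rw [hab, map_mul, ha] at h
    linarith
  have ht : g.re = a.re * b.re - a.imI * b.imI - a.imJ * b.imJ - a.imK * b.imK := by
    rw [hab, Quaternion.re_mul]
  rw [Quaternion.normSq_def'] at ha hb
  obtain ⟨c, hc, hl⟩ := exists_linear_form_of_sum_sq_eq_thirtyFive
    ![a.re, a.imI, a.imJ, a.imK] ![b.re, -b.imI, -b.imJ, -b.imK]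
    (by simpa [Fin.sum_univ_four] using ha)
  have hcn : ∑ i, c i ^ 2 = n := by
    rw [hc, ← hb]; simp [Fin.sum_univ_four]
  have htl : ∑ i, ![a.re, a.imI, a.imJ, a.imK] i * ![b.re, -b.imI, -b.imJ, -b.imK] i = g.re := by
    rw [ht]; simp [Fin.sum_univ_four]; ring
  rw [htl] at hl
  simpa [hcn] using exists_rat_of_linear_form c g.re hl

theorem stmt_18 (l : ℤ) (hl : l = 1 ∨ l = 2) (m : ℕ) (hm : m = 2 ∨ m = 3) (n : ℕ) :
    ∃ (x y : ℤ) (z w : ℚ), (n : ℚ) = (x : ℚ) ^ 2 + (y : ℚ) ^ 2 + z ^ 2 + w ^ 2 ∧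
      (∃ Z : ℤ, 5 * z = (Z : ℚ)) ∧ (∃ W : ℤ, 5 * w = (W : ℚ)) ∧
      ∃ r : ℕ, (x : ℚ) + 3 * (y : ℚ) + 5 * z = (l : ℚ) * (r : ℚ) ^ m := by
  obtain ⟨r, A, B, C, h⟩ := exists_isSumThreeSq_sub_sq l hl m hm n
  obtain ⟨x, y, z, w, hn, hz, hw, hr⟩ :=
    exists_rat_of_eq_sum_four_sq n (l * (r : ℤ) ^ m) A B C (by linarith)
  exact ⟨x, y, z, w, hn, hz, hw, r, by rw [hr]; push_cast; rfl⟩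
end
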